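/- Fix N ≥ 1 and integers k_p ≥ 1 for p ∈ [N]. The Inc(ℕ)-divisibility order ≼ on the set G of good tuples is a well-partial-order, where A ≼ B if and only if there exists π ∈ Inc(ℕ) such that B − πA is entrywise nonnegative and good. -/

import Mathlib

/-- `A ∈ ℕ^{[k]×ℕ}` is good of degree `d`: it has finitely many nonzero entries, all row
sums equal `d`, and every column sum is at most `d`. -/
def IsGood {k : ℕ} (A : Fin k → ℕ → ℕ) (d : ℕ) : Prop :=
  {q : Fin k × ℕ | A q.1 q.2 ≠ 0}.Finite ∧
    (∀ i, ∑ᶠ j, A i j = d) ∧ ∀ j, (∑ i, A i j) ≤ d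

/-- A tuple `A = (A_p)_{p ∈ [N]}` of matrices `A_p ∈ ℕ^{[k_p]×ℕ}` is good if for every `p`
the matrix `A_p` is good of some degree `d_{A,p}`. -/
def IsGoodTuple {N : ℕ} (k : Fin N → ℕ) (A : ∀ p : Fin N, Fin (k p) → ℕ → ℕ)
    (d : Fin N → ℕ) : Prop :=
  ∀ p, IsGood (A p) (d p)

/-- The action of a map `π : ℕ → ℕ` on matrices by moving columns: `colShift π A` has
column `A_{·,j}` at position `π(j)` for every `j`, and zero columns at positions outside
the image of `π`. -/
noncomputable def colShift {k : ℕ} (π : ℕ → ℕ) (A : Fin k → ℕ → ℕ) : Fin k → ℕ → ℕ :=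
  fun i => Function.extend π (A i) (fun _ => 0)

/-- The Inc(ℕ)-divisibility order on good tuples: `A ≼ B` iff there is a strictly
increasing `π : ℕ → ℕ` such that `B − πA` is entrywise nonnegative and good. -/
def IncDivTuple {N : ℕ} (k : Fin N → ℕ) (A B : ∀ p : Fin N, Fin (k p) → ℕ → ℕ) : Prop :=
  ∃ π : ℕ → ℕ, StrictMono π ∧ (∀ p i j, colShift π (A p) i j ≤ B p i j) ∧
    ∃ d : Fin N → ℕ, IsGoodTuple k (fun p i j => B p i j - colShift π (A p) i j) d

/-- `MarkedEmb M l₁ l₂`: the list `l₁` is dominated entrywise by a sublist of `l₂` that contains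
all letters of `l₂` marked by `M`. -/
inductive MarkedEmb {α : Type*} [Preorder α] (M : α → Bool) : List α → List α → Prop
  | nil : MarkedEmb M [] []
  | skip {b : α} {l₁ l₂ : List α} (hb : M b = false) (h : MarkedEmb M l₁ l₂) :
      MarkedEmb M l₁ (b :: l₂)
  | cons {a b : α} {l₁ l₂ : List α} (hab : a ≤ b) (h : MarkedEmb M l₁ l₂) :
      MarkedEmb M (a :: l₁) (b :: l₂)

namespace MarkedEmb

variable {α : Type*} [Preorder α] {M : α → Bool}

theorem append {u₁ u₂ v₁ v₂ : List α} (hu : MarkedEmb M u₁ u₂) (hv : MarkedEmb M v₁ v₂) :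
    MarkedEmb M (u₁ ++ v₁) (u₂ ++ v₂) := by
  induction hu with
  | nil => exact hv
  | skip hb _ ih => exact .skip hb ih
  | cons hab _ ih => exact .cons hab ih

theorem nil_left {l : List α} (hl : ∀ b ∈ l, M b = false) : MarkedEmb M [] l := by
  induction l with
  | nil => exact .nil
  | cons b l ih =>
    exact .skip (hl b (by simp)) (ih fun c hc => hl c (by simp [hc]))

theorem of_sublistForall₂ {l₁ l₂ : List α} (h : List.SublistForall₂ (· ≤ ·) l₁ l₂)
    (hl : ∀ b ∈ l₂, M b = false) : MarkedEmb M l₁ l₂ := by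
  induction h with
  | nil => exact nil_left hl
  | cons hab _ ih => exact .cons hab (ih fun c hc => hl c (by simp [hc]))
  | cons_right _ ih => exact .skip (hl _ (by simp)) (ih fun c hc => hl c (by simp [hc]))

/-- A marked embedding is realized by a strictly increasing map of positions which maps
positions past the end of `l₁` to positions past the end of `l₂`. -/
theorem exists_strictMono {l₁ l₂ : List α} (h : MarkedEmb M l₁ l₂) :
    ∃ π : ℕ → ℕ, StrictMono π ∧
      (∀ i a, l₁[i]? = some a → ∃ b, l₂[π i]? = some b ∧ a ≤ b) ∧
      (∀ i, l₁[i]? = none → l₂[π i]? = none) ∧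
      ∀ j b, l₂[j]? = some b → j ∉ Set.range π → M b = false := by
  induction h with
  | nil => exact ⟨id, strictMono_id, by simp, by simp, by simp⟩
  | @skip b l₁ l₂ hb _ ih =>
    obtain ⟨π, hπ, h1, h2, h3⟩ := ih
    refine ⟨fun i => π i + 1, fun i j hij => by simpa using hπ hij, ?_, ?_, ?_⟩
    · simpa using h1
    · simpa using h2
    · rintro (_ | j) c hc hj
      · obtain rfl : b = c := by simpa using hc
        exact hb
      · exact h3 j c (by simpa using hc) (by simpa using hj)
  | @cons a b l₁ l₂ hab _ ih =>
    obtain ⟨π, hπ, h1, h2, h3⟩ := ih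
    refine ⟨fun i => Nat.casesOn i 0 fun i => π i + 1, ?_, ?_, ?_, ?_⟩
    · rintro (_ | i) (_ | j) hij
      · omega
      · simp
      · omega
      · simpa using hπ (Nat.succ_lt_succ_iff.1 hij)
    · rintro (_ | i) c hc
      · obtain rfl : a = c := by simpa using hc
        exact ⟨b, by simp, hab⟩
      · simpa using h1 i c (by simpa using hc)
    · rintro (_ | i) hc
      · simp at hc
      · simpa using h2 i (by simpa using hc)
    · rintro (_ | j) c hc hj
      · exact absurd ⟨0, rfl⟩ hj
      · refine h3 j c (by simpa using hc) ?_
        rintro ⟨i, rfl⟩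
        exact hj ⟨i + 1, rfl⟩

end MarkedEmb

/-- Higman's lemma for words in which a bounded number of letters is marked, with respect to
embeddings that hit all marked letters. -/
theorem partiallyWellOrderedOn_markedEmb {α : Type*} [Preorder α] [WellQuasiOrderedLE α]
    (M : α → Bool) (m : ℕ) :
    {l : List α | l.countP M ≤ m}.PartiallyWellOrderedOn (MarkedEmb M) := by
  have higman : {l : List α | ∀ x ∈ l, x ∈ {a | M a = false}}.PartiallyWellOrderedOn
      (List.SublistForall₂ (· ≤ ·)) :=
    Set.PartiallyWellOrderedOn.partiallyWellOrderedOn_sublistForall₂ _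
      (Set.partiallyWellOrderedOn_of_wellQuasiOrdered wellQuasiOrdered_le _)
  have unmarked : {l : List α | ∀ x ∈ l, M x = false}.PartiallyWellOrderedOn (MarkedEmb M) := by
    have := higman.image_of_monotone_on (r' := MarkedEmb M) (f := id)
      fun l₁ _ l₂ h₂ h => MarkedEmb.of_sublistForall₂ h h₂
    simpa using this
  induction m with
  | zero =>
    refine unmarked.mono fun l hl x hx => ?_
    simpa using List.countP_eq_zero.1 (Nat.le_zero.1 hl) x hx
  | succ m ih =>
    have huniv : (Set.univ : Set α).PartiallyWellOrderedOn (· ≤ ·) :=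
      Set.partiallyWellOrderedOn_of_wellQuasiOrdered wellQuasiOrdered_le _
    have : IsPreorder (List α) (List.SublistForall₂ (· ≤ ·)) :=
      { refl := refl_of _, trans := fun _ _ _ => trans_of _ }
    have himage := (higman.prod (huniv.prod ih)).image_of_monotone_on (r' := MarkedEmb M)
      (f := fun x => x.1 ++ x.2.1 :: x.2.2) fun x _ y hy h =>
        (MarkedEmb.of_sublistForall₂ h.1 hy.1).append (.cons h.2.1 h.2.2)
    refine (unmarked.union himage).mono fun l hl => ?_
    by_cases hM : ∃ x ∈ l, M x = true
    · right
      obtain ⟨x, u, v, hu, hx, rfl, -⟩ := List.exists_of_eraseP hM.choose_spec.1 hM.choose_spec.2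
      refine ⟨(u, x, v), ⟨fun y hy => by simpa using hu y hy, trivial, ?_⟩, rfl⟩
      have : (u ++ x :: v).countP M ≤ m + 1 := hl
      rw [List.countP_append, List.countP_cons_of_pos hx] at this
      change v.countP M ≤ m
      omega
    · left
      intro x hx
      by_contra h
      exact hM ⟨x, hx, by simpa using h⟩

/-- Every sequence of natural numbers has a subsequence that is constant or at least doubles
at each step. -/
theorem Nat.exists_subseq_const_or_two_mul_le (d : ℕ → ℕ) :
    ∃ φ : ℕ → ℕ, StrictMono φ ∧
      ((∀ m n, m < n → d (φ m) = d (φ n)) ∨ ∀ m n, m < n → 2 * d (φ m) ≤ d (φ n)) := by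
  have : IsTrans ℕ fun x y => 2 * x ≤ y := ⟨fun x y z h₁ h₂ => by omega⟩
  obtain ⟨g, hg | hg⟩ := exists_increasing_or_nonincreasing_subseq (fun x y => 2 * x ≤ y) d
  · exact ⟨g, g.strictMono, .inr hg⟩
  obtain ⟨g', hg' | hg'⟩ := exists_increasing_or_nonincreasing_subseq (· = ·) (d ∘ g)
  · exact ⟨g ∘ g', g.strictMono.comp g'.strictMono, .inl hg'⟩
  · have hfin : (Set.Iio (2 * d (g 0) + 1)).Finite := Set.finite_Iio _
    obtain ⟨m, n, hmn, h⟩ := hfin.exists_lt_map_eq_of_forall_mem (f := fun n => d (g (g' n)))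
      fun n => by
        rcases Nat.eq_zero_or_pos (g' n) with h | h
        · simp only [h, Set.mem_Iio]; omega
        · have := hg 0 _ h
          simp only [Set.mem_Iio]; omega
    exact absurd h (hg' m n hmn)

theorem exists_subseq_forall_const_or_two_mul_le {ι : Type*} [Finite ι] (d : ℕ → ι → ℕ) :
    ∃ φ : ℕ → ℕ, StrictMono φ ∧ ∀ p,
      (∀ m n, m < n → d (φ m) p = d (φ n) p) ∨ ∀ m n, m < n → 2 * d (φ m) p ≤ d (φ n) p := by
  have := Fintype.ofFinite ι
  suffices ∀ s : Finset ι, ∃ φ : ℕ → ℕ, StrictMono φ ∧ ∀ p ∈ s,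
      (∀ m n, m < n → d (φ m) p = d (φ n) p) ∨ ∀ m n, m < n → 2 * d (φ m) p ≤ d (φ n) p by
    simpa using this Finset.univ
  intro s
  induction s using Finset.cons_induction with
  | empty => exact ⟨id, strictMono_id, by simp⟩
  | cons p s hp ih =>
    obtain ⟨φ, hφ, h⟩ := ih
    obtain ⟨ψ, hψ, h'⟩ := Nat.exists_subseq_const_or_two_mul_le fun n => d (φ n) p
    refine ⟨φ ∘ ψ, hφ.comp hψ, (Finset.forall_mem_cons _ _).2 ⟨h', fun q hq => ?_⟩⟩
    exact (h q hq).imp (fun H m n hmn => H _ _ (hψ hmn)) fun H m n hmn => H _ _ (hψ hmn)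

theorem colShift_apply {k : ℕ} {π : ℕ → ℕ} (hπ : Function.Injective π) (A : Fin k → ℕ → ℕ)
    (i : Fin k) (j : ℕ) : colShift π A i (π j) = A i j :=
  hπ.extend_apply _ _ _

theorem colShift_apply_of_notMem {k : ℕ} {π : ℕ → ℕ} (A : Fin k → ℕ → ℕ) (i : Fin k) {j : ℕ}
    (hj : j ∉ Set.range π) : colShift π A i j = 0 :=
  Function.extend_apply' _ _ _ hj

theorem finsum_colShift {k : ℕ} {π : ℕ → ℕ} (hπ : Function.Injective π) (A : Fin k → ℕ → ℕ)
    (i : Fin k) : ∑ᶠ j, colShift π A i j = ∑ᶠ j, A i j := by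
  have h : ∑ᶠ j ∈ Set.range π, colShift π A i j = ∑ᶠ j, colShift π A i (π j) :=
    finsum_mem_range hπ
  rw [← finsum_mem_univ, ← finsum_mem_inter_support_eq' _ (Set.range π), h]
  · simp_rw [colShift_apply hπ]
  · intro j hj
    refine ⟨fun _ => trivial, fun _ => ?_⟩
    by_contra h'
    exact hj (colShift_apply_of_notMem A i h')

namespace IsGood

variable {k : ℕ} {A B : Fin k → ℕ → ℕ} {d e : ℕ}

theorem finite_support_row (hA : IsGood A d) (i : Fin k) : (Function.support (A i)).Finite :=
  (hA.1.image Prod.snd).subset fun j hj => ⟨(i, j), hj, rfl⟩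

theorem exists_forall_ge_eq_zero (hA : IsGood A d) : ∃ L, ∀ j, L ≤ j → ∀ i, A i j = 0 := by
  obtain ⟨L, hL⟩ := (hA.1.image Prod.snd).bddAbove
  refine ⟨L + 1, fun j hj i => ?_⟩
  by_contra h
  have : j ≤ L := hL ⟨(i, j), h, rfl⟩
  omega

theorem sum_range_le (hA : IsGood A d) (L : ℕ) : ∑ j ∈ Finset.range L, ∑ i, A i j ≤ k * d := by
  rw [Finset.sum_comm]
  calc ∑ i, ∑ j ∈ Finset.range L, A i j ≤ ∑ _i : Fin k, d := by
        refine Finset.sum_le_sum fun i _ => ?_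
        rw [← hA.2.1 i, finsum_eq_sum_of_support_subset (s := (hA.finite_support_row i).toFinset ∪
          Finset.range L) _ (by intro j hj; simp_all)]
        exact Finset.sum_le_sum_of_subset Finset.subset_union_right
    _ = k * d := by simp

theorem card_filter_pos_le (hA : IsGood A d) (L : ℕ) :
    ((Finset.range L).filter fun j => 0 < ∑ i, A i j).card ≤ k * d := by
  refine le_trans ?_ (hA.sum_range_le L)
  refine le_trans ?_
    (Finset.sum_le_sum_of_subset (Finset.filter_subset (fun j => 0 < ∑ i, A i j) _))
  rw [Finset.card_eq_sum_ones]
  exact Finset.sum_le_sum fun j hj => (Finset.mem_filter.1 hj).2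

theorem card_filter_lt_two_mul_le (hA : IsGood A d) (L : ℕ) :
    ((Finset.range L).filter fun j => d < 2 * ∑ i, A i j).card ≤ 2 * k := by
  set s := (Finset.range L).filter fun j => d < 2 * ∑ i, A i j
  have h : s.card * (d + 1) ≤ 2 * (k * d) := by
    calc s.card * (d + 1) = ∑ j ∈ s, (d + 1) := by simp
      _ ≤ ∑ j ∈ s, 2 * ∑ i, A i j := Finset.sum_le_sum fun j hj => (Finset.mem_filter.1 hj).2
      _ = 2 * ∑ j ∈ s, ∑ i, A i j := by rw [Finset.mul_sum]
      _ ≤ 2 * (k * d) := Nat.mul_le_mul_left _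
        ((Finset.sum_le_sum_of_subset (Finset.filter_subset _ _)).trans (hA.sum_range_le L))
  by_contra! hlt
  nlinarith

theorem sub_colShift (hA : IsGood A d) (hB : IsGood B e) {π : ℕ → ℕ} (hπ : Function.Injective π)
    (hle : ∀ i j, colShift π A i j ≤ B i j)
    (hslack : ∀ j, (∑ i, B i (π j)) + d ≤ (∑ i, A i j) + e)
    (hrest : ∀ j ∉ Set.range π, (∑ i, B i j) + d ≤ e) :
    IsGood (fun i j => B i j - colShift π A i j) (e - d) := by
  refine ⟨hB.1.subset fun q hq h => hq (by simp [h]), fun i => ?_, fun j => ?_⟩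
  · have hsub : (Function.support fun j => B i j - colShift π A i j).Finite :=
      (hB.finite_support_row i).subset fun j hj h => hj (by simp [h])
    have hshift : (Function.support (colShift π A i)).Finite :=
      (hB.finite_support_row i).subset fun j hj h => hj (Nat.le_zero.1 (h ▸ hle i j))
    have hadd := finsum_add_distrib hsub hshift
    simp_rw [Nat.sub_add_cancel (hle i _)] at hadd
    rw [hB.2.1, finsum_colShift hπ, hA.2.1] at hadd
    exact Nat.eq_sub_of_add_eq hadd.symm
  · rw [Finset.sum_tsub_distrib _ fun i _ => hle i j]
    by_cases hj : j ∈ Set.range π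
    · obtain ⟨j, rfl⟩ := hj
      simp_rw [colShift_apply hπ]
      have := hslack j
      omega
    · simp_rw [colShift_apply_of_notMem A _ hj]
      have := hrest j hj
      simp only [Finset.sum_const_zero]
      omega

end IsGood

/-- The Inc(ℕ)-divisibility order ≼ on the set G of good tuples is a well-partial-order. -/
theorem goodTuple_wpo (N : ℕ) (hN : 1 ≤ N) (k : Fin N → ℕ) (hk : ∀ p, 1 ≤ k p)
    (f : ℕ → {A : ∀ p : Fin N, Fin (k p) → ℕ → ℕ // ∃ d, IsGoodTuple k A d}) :
    ∃ i j : ℕ, i < j ∧ IncDivTuple k (f i).1 (f j).1 := by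
  choose d hd using fun n => (f n).2
  obtain ⟨φ, hφ, hcd⟩ := exists_subseq_forall_const_or_two_mul_le d
  classical
  set A : ℕ → ∀ p, Fin (k p) → ℕ → ℕ := fun n => (f (φ n)).1
  set e : ℕ → Fin N → ℕ := fun n => d (φ n)
  have hgood : ∀ n p, IsGood (A n p) (e n p) := fun n => hd (φ n)
  set C : Fin N → Prop := fun p => ∀ m n, m < n → e m p = e n p
  let mark : ℕ → Fin N → ℕ → Prop := fun n p j =>
    if C p then 0 < ∑ i, A n p i j else e n p < 2 * ∑ i, A n p i j
  let letter : ℕ → ℕ → ((∀ p, Fin (k p) → ℕ) × (Fin N → ℕ)) × Bool := fun n j =>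
    ((fun p i => A n p i j, fun p => e n p - ∑ i, A n p i j), decide (∃ p, mark n p j))
  have hL : ∀ n, ∃ L, ∀ p j, L ≤ j → ∀ i, A n p i j = 0 := by
    intro n
    choose L hL using fun p => (hgood n p).exists_forall_ge_eq_zero
    exact ⟨Finset.univ.sup L, fun p j hj => hL p j ((Finset.le_sup (Finset.mem_univ p)).trans hj)⟩
  choose L hL using hL
  let word : ℕ → List (((∀ p, Fin (k p) → ℕ) × (Fin N → ℕ)) × Bool) := fun n =>
    (List.range (L n)).map (letter n)
  have hcount : ∀ n, (word n).countP Prod.snd ≤ ∑ p, (k p * e 0 p + 2 * k p) := by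
    intro n
    have h1 : (word n).countP Prod.snd
        = ((Finset.range (L n)).filter fun j => ∃ p, mark n p j).card := by
      rw [← Nat.count_eq_card_filter_range, Nat.count, List.countP_map]
      rfl
    rw [h1]
    have h2 : ((Finset.range (L n)).filter fun j => ∃ p, mark n p j)
        ⊆ Finset.univ.biUnion fun p => (Finset.range (L n)).filter fun j => mark n p j := by
      intro j
      simp
    refine (Finset.card_le_card h2).trans (Finset.card_biUnion_le.trans ?_)
    refine Finset.sum_le_sum fun p _ => ?_
    by_cases hp : C p
    · simp only [mark, hp, if_true]
      have h0 : e 0 p = e n p := by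
        rcases Nat.eq_zero_or_pos n with rfl | hn
        · rfl
        · exact hp 0 n hn
      rw [h0]
      exact ((hgood n p).card_filter_pos_le _).trans (Nat.le_add_right _ _)
    · simp only [mark, hp, if_false]
      exact ((hgood n p).card_filter_lt_two_mul_le _).trans (Nat.le_add_left _ _)
  obtain ⟨m, n, hmn, hemb⟩ :=
    (partiallyWellOrderedOn_markedEmb Prod.snd _).exists_lt hcount
  obtain ⟨π, hπ, h1, h2, h3⟩ := hemb.exists_strictMono
  have hsome : ∀ n j, j < L n → (word n)[j]? = some (letter n j) := by
    intro n j hj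
    simp [word, hj]
  have hnone : ∀ n j, (word n)[j]? = none ↔ L n ≤ j := by
    intro n j
    simp [word]
  have hmono : ∀ p, e m p ≤ e n p := fun p =>
    (hcd p).elim (fun h => (h m n hmn).le) fun h => by
      have : 2 * e m p ≤ e n p := h m n hmn
      omega
  have hmatch : ∀ j, j < L m → letter m j ≤ letter n (π j) := by
    intro j hj
    obtain ⟨b, hb, hle⟩ := h1 j _ (hsome m j hj)
    have hlt : π j < L n := by
      by_contra! h
      rw [(hnone n _).2 h] at hb
      cases hb
    rw [hsome n _ hlt] at hb
    cases hb
    exact hle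
  have hzero : ∀ j, L m ≤ j → L n ≤ π j := fun j hj => (hnone n _).1 (h2 j ((hnone m j).2 hj))
  have hle : ∀ p i j, colShift π (A m p) i j ≤ A n p i j := by
    intro p i j
    by_cases hj : j ∈ Set.range π
    · obtain ⟨j, rfl⟩ := hj
      rw [colShift_apply hπ.injective]
      rcases lt_or_ge j (L m) with h | h
      · exact (hmatch j h).1.1 p i
      · simp [hL m p j h i]
    · simp [colShift_apply_of_notMem _ _ hj]
  refine ⟨φ m, φ n, hφ hmn, π, hπ, hle, fun p => e n p - e m p, fun p => ?_⟩
  refine (hgood m p).sub_colShift (hgood n p) hπ.injective (hle p) (fun j => ?_) fun j hj => ?_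
  · rcases lt_or_ge j (L m) with h | h
    · have hs : e m p - ∑ i, A m p i j ≤ e n p - ∑ i, A n p i (π j) := (hmatch j h).1.2 p
      have := (hgood m p).2.2 j
      have := (hgood n p).2.2 (π j)
      omega
    · have := hmono p
      simp only [hL m p j h, hL n p _ (hzero j h), Finset.sum_const_zero]
      omega
  · rcases lt_or_ge j (L n) with h | h
    · have hm : ¬ mark n p j := fun hm => by
        have := h3 j _ (hsome n j h) hj
        exact (of_decide_eq_false this) ⟨p, hm⟩
      by_cases hp : C p
      · simp only [mark, hp, if_true] at hm
        have : e m p = e n p := hp m n hmn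
        omega
      · simp only [mark, hp, if_false] at hm
        have : 2 * e m p ≤ e n p := ((hcd p).resolve_left hp) m n hmn
        omega
    · have := hmono p
      simp only [hL n p j h, Finset.sum_const_zero]
      omega
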